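/- Let A be a C*-algebra, M a von Neumann algebra on a complex Hilbert space H, φ : A → M a linear map, and ψ₁, ψ₂ : A → M completely positive maps such that the map Ψ : A → M₂(M), Ψ(a) = [[ψ₁(a), φ(a*)*], [φ(a), ψ₂(a)]], is completely positive. Write φ†(a) = φ(a*)* and set φ₁ = ¼(ψ₁+ψ₂+φ+φ†), φ₂ = ¼(ψ₁+ψ₂−φ−φ†), φ₃ = ¼(ψ₁+ψ₂−iφ+iφ†), φ₄ = ¼(ψ₁+ψ₂+iφ−iφ†). Then φ₁, φ₂, φ₃, φ₄ are completely positive maps from A to M and φ = φ₁ − φ₂ + i(φ₃ − φ₄). -/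

import Mathlib

open scoped Matrix

noncomputable section

/-- The C*-norm of a square matrix over a (possibly non-unital) C*-algebra `A`, defined
intrinsically via the spectral radius in the unitization: `‖x‖ = √(spectralRadius ℂ (xᴴ * x))`.
This agrees with the unique C*-norm on `Mₙ(A)`. -/
def cstarMatrixNorm {A : Type*} [NonUnitalCStarAlgebra A] {n : ℕ}
    (x : Matrix (Fin n) (Fin n) A) : ℝ :=
  Real.sqrt ((spectralRadius ℂ
    ((x.map (Unitization.inr : A → Unitization ℂ A))ᴴ *
      x.map (Unitization.inr : A → Unitization ℂ A))).toReal)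

/-- A map between C*-algebras is *completely bounded* if the norms of its amplifications
`φ⁽ⁿ⁾ : Mₙ(A) → Mₙ(B)`, `(aᵢⱼ) ↦ (φ(aᵢⱼ))`, are uniformly bounded. -/
def CompletelyBounded {A B : Type*} [NonUnitalCStarAlgebra A] [NonUnitalCStarAlgebra B]
    (φ : A → B) : Prop :=
  ∃ C : ℝ, ∀ (n : ℕ) (x : Matrix (Fin n) (Fin n) A),
    cstarMatrixNorm (x.map φ) ≤ C * cstarMatrixNorm x

/-- Positivity of a square matrix over a C*-algebra: `x ≥ 0` iff `x = yᴴ * y` for some `y`. -/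
def MatIsPos {B : Type*} [NonUnitalSemiring B] [StarRing B] {n : ℕ}
    (x : Matrix (Fin n) (Fin n) B) : Prop :=
  ∃ y : Matrix (Fin n) (Fin n) B, x = yᴴ * y

/-- A map between C*-algebras is *completely positive* if all of its amplifications
`(aᵢⱼ) ↦ (φ(aᵢⱼ))` map positive matrices to positive matrices. -/
def CompletelyPositive {A B : Type*} [NonUnitalSemiring A] [StarRing A]
    [NonUnitalSemiring B] [StarRing B] (φ : A → B) : Prop :=
  ∀ (n : ℕ) (x : Matrix (Fin n) (Fin n) A), MatIsPos x → MatIsPos (x.map φ)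

/-- A map between C*-algebras is a `*`-representation if it is multiplicative and
star-preserving (linearity/boundedness are imposed on the ambient data separately). -/
def IsStarRep {A B : Type*} [Mul A] [Star A] [Mul B] [Star B] (ψ : A → B) : Prop :=
  (∀ a b, ψ (a * b) = ψ a * ψ b) ∧ ∀ a, ψ (star a) = star (ψ a)

/-- In a C*-algebra, `a⋆ a + b⋆ b` is again of the form `c⋆ c`. -/
theorem exists_star_mul_self_add_star_mul_self {C : Type*} [NonUnitalCStarAlgebra C] (a b : C) :
    ∃ c : C, star a * a + star b * b = star c * c := by
  let : PartialOrder C := CStarAlgebra.spectralOrder C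
  have : StarOrderedRing C := CStarAlgebra.spectralOrderedRing C
  exact CStarAlgebra.nonneg_iff_eq_star_mul_self.mp
    (add_nonneg (star_mul_self_nonneg a) (star_mul_self_nonneg b))

/-- A sum of two positive matrices over a C*-algebra is positive. -/
theorem MatIsPos.add {B : Type*} [CStarAlgebra B] [PartialOrder B] [StarOrderedRing B] {n : ℕ}
    {x y : Matrix (Fin n) (Fin n) B} (hx : MatIsPos x) (hy : MatIsPos y) :
    MatIsPos (x + y) := by
  obtain ⟨a, rfl⟩ := hx
  obtain ⟨b, rfl⟩ := hy
  obtain ⟨c, hc⟩ := exists_star_mul_self_add_star_mul_self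
    (CStarMatrix.ofMatrix a) (CStarMatrix.ofMatrix b)
  exact ⟨CStarMatrix.ofMatrix.symm c, hc⟩

/-- Compressing a positive matrix of `2 × 2` blocks by the column `(1, z) / 2` in each block
gives a positive matrix. -/
theorem MatIsPos.compress {B : Type*} [CStarAlgebra B] [PartialOrder B] [StarOrderedRing B]
    {n : ℕ} {x : Matrix (Fin n) (Fin n) (Matrix (Fin 2) (Fin 2) B)} (hx : MatIsPos x) (z : ℂ) :
    MatIsPos (Matrix.of fun i j => (4 : ℂ)⁻¹ •
      (x i j 0 0 + z • x i j 0 1 + star z • x i j 1 0 + (star z * z) • x i j 1 1)) := by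
  obtain ⟨y, rfl⟩ := hx
  have key : ∀ c : Fin 2, MatIsPos _ := fun c =>
    ⟨Matrix.of fun k j => (2 : ℂ)⁻¹ • (y k j c 0 + z • y k j c 1), rfl⟩
  convert (key 0).add (key 1) using 1
  ext i j
  simp only [Matrix.of_apply, Matrix.add_apply, Matrix.mul_apply, Matrix.conjTranspose_apply,
    Matrix.sum_apply, Matrix.star_apply, Finset.smul_sum, ← Finset.sum_add_distrib,
    Fin.sum_univ_two, star_smul, star_add]
  refine Finset.sum_congr rfl fun k _ => ?_
  simp only [mul_add, add_mul, smul_mul_assoc, mul_smul_comm, star_inv₀, star_ofNat]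
  module

/-- If `[[ψ₁, χ], [φ, ψ₂]]` is completely positive, so is `¼ (ψ₁ + z χ + z̄ φ + ψ₂)` for
unimodular `z`. -/
theorem CompletelyPositive.compress {A B : Type*} [NonUnitalSemiring A] [StarRing A]
    [CStarAlgebra B] [PartialOrder B] [StarOrderedRing B] {ψ₁ χ φ ψ₂ θ : A → B}
    (h : CompletelyPositive fun a => (!![ψ₁ a, χ a; φ a, ψ₂ a] : Matrix (Fin 2) (Fin 2) B))
    {z : ℂ} (hz : star z * z = 1)
    (hθ : ∀ a, θ a = (4 : ℂ)⁻¹ • (ψ₁ a + z • χ a + star z • φ a + ψ₂ a)) :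
    CompletelyPositive θ := by
  intro n x hx
  convert (h n x hx).compress z using 1
  ext i j : 2
  simp only [hθ, hz, Matrix.map_apply, Matrix.of_apply, Matrix.cons_val', Matrix.cons_val_zero,
    Matrix.cons_val_one, Matrix.cons_val_fin_one, one_smul]

/-- If `Ψ(a) = [[ψ₁ a, φ(a*)*], [φ a, ψ₂ a]]` is completely positive (with `ψ₁, ψ₂` completely
positive into `M`), then, writing `φ†(a) = φ(a*)*`, the maps `φ₁ = ¼(ψ₁+ψ₂+φ+φ†)`,
`φ₂ = ¼(ψ₁+ψ₂−φ−φ†)`, `φ₃ = ¼(ψ₁+ψ₂−iφ+iφ†)`, `φ₄ = ¼(ψ₁+ψ₂+iφ−iφ†)` are completely positive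
into `M` and `φ = φ₁ − φ₂ + i(φ₃ − φ₄)`. -/
theorem matrix_trick_decomposition
    {A : Type*} [NonUnitalCStarAlgebra A]
    {H : Type*} [NormedAddCommGroup H] [InnerProductSpace ℂ H] [CompleteSpace H]
    (M : VonNeumannAlgebra H)
    (φ : A →ₗ[ℂ] (H →L[ℂ] H)) (hφmem : ∀ a : A, φ a ∈ M)
    (ψ₁ ψ₂ : A →ₗ[ℂ] (H →L[ℂ] H))
    (hψ₁mem : ∀ a : A, ψ₁ a ∈ M) (hψ₁cp : CompletelyPositive (⇑ψ₁))
    (hψ₂mem : ∀ a : A, ψ₂ a ∈ M) (hψ₂cp : CompletelyPositive (⇑ψ₂))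
    (hΨ : CompletelyPositive
      (fun a : A => (!![ψ₁ a, star (φ (star a)); φ a, ψ₂ a] :
        Matrix (Fin 2) (Fin 2) (H →L[ℂ] H)))) :
    ∀ φdag φ₁ φ₂ φ₃ φ₄ : A → (H →L[ℂ] H),
      (∀ a, φdag a = star (φ (star a))) →
      (∀ a, φ₁ a = (4 : ℂ)⁻¹ • (ψ₁ a + ψ₂ a + φ a + φdag a)) →
      (∀ a, φ₂ a = (4 : ℂ)⁻¹ • (ψ₁ a + ψ₂ a - φ a - φdag a)) →
      (∀ a, φ₃ a = (4 : ℂ)⁻¹ •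
        (ψ₁ a + ψ₂ a - Complex.I • φ a + Complex.I • φdag a)) →
      (∀ a, φ₄ a = (4 : ℂ)⁻¹ •
        (ψ₁ a + ψ₂ a + Complex.I • φ a - Complex.I • φdag a)) →
      (CompletelyPositive φ₁ ∧ ∀ a, φ₁ a ∈ M) ∧
      (CompletelyPositive φ₂ ∧ ∀ a, φ₂ a ∈ M) ∧
      (CompletelyPositive φ₃ ∧ ∀ a, φ₃ a ∈ M) ∧
      (CompletelyPositive φ₄ ∧ ∀ a, φ₄ a ∈ M) ∧
      ∀ a : A, φ a = φ₁ a - φ₂ a + Complex.I • (φ₃ a - φ₄ a) := by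
  intro φdag φ₁ φ₂ φ₃ φ₄ hd h₁ h₂ h₃ h₄
  have hdmem : ∀ a, φdag a ∈ M := fun a => hd a ▸ star_mem (hφmem _)
  have hs : ∀ (c : ℂ) {T : H →L[ℂ] H}, T ∈ M → c • T ∈ M := fun c _ hT =>
    M.toStarSubalgebra.smul_mem hT c
  have hsum : ∀ a, ψ₁ a + ψ₂ a ∈ M := fun a => add_mem (hψ₁mem a) (hψ₂mem a)
  refine ⟨⟨hΨ.compress (z := 1) (by simp) fun a => ?_, fun a => ?_⟩,
    ⟨hΨ.compress (z := -1) (by simp) fun a => ?_, fun a => ?_⟩,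
    ⟨hΨ.compress (z := Complex.I) (by simp) fun a => ?_, fun a => ?_⟩,
    ⟨hΨ.compress (z := -Complex.I) (by simp) fun a => ?_, fun a => ?_⟩, fun a => ?_⟩
  · simp only [h₁, hd, star_one]
    module
  · rw [h₁]
    exact hs _ (add_mem (add_mem (hsum a) (hφmem a)) (hdmem a))
  · simp only [h₂, hd, star_neg, star_one]
    module
  · rw [h₂]
    exact hs _ (sub_mem (sub_mem (hsum a) (hφmem a)) (hdmem a))
  · simp only [h₃, hd, Complex.star_def, Complex.conj_I]
    module
  · rw [h₃]
    exact hs _ (add_mem (sub_mem (hsum a) (hs _ (hφmem a))) (hs _ (hdmem a)))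
  · simp only [h₄, hd, star_neg, Complex.star_def, Complex.conj_I, neg_neg]
    module
  · rw [h₄]
    exact hs _ (sub_mem (add_mem (hsum a) (hs _ (hφmem a))) (hs _ (hdmem a)))
  · rw [h₁, h₂, h₃, h₄]
    match_scalars <;> ring_nf <;> norm_num [Complex.I_sq]
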